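/- Assume 𝔄 acts trivially on 𝒜 from the left, 𝒜/J has a left identity, and 𝔄 has a bounded approximate identity for 𝒜. If 𝒜 is module biflat as an 𝔄-module, then the quotient Banach algebra 𝒜/J is biflat. -/

import Mathlib

noncomputable section

open scoped Topology

universe u u₁ u₂ u₃ v w

/-- The smallest closed two-sided ideal (realized as a `ℂ`-submodule which is topologically
closed and stable under multiplication by arbitrary elements) containing a given set. -/
def closedIdealGen {R : Type u} [NonUnitalNormedRing R] [NormedSpace ℂ R] (s : Set R) :
    Submodule ℂ R :=
  sInf {p : Submodule ℂ R |
    s ⊆ (p : Set R) ∧ IsClosed (p : Set R) ∧ ∀ x ∈ p, ∀ y : R, x * y ∈ p ∧ y * x ∈ p}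

/-- Data exhibiting the Banach space `TB` as the projective tensor product `B ⊗̂ B` of a
Banach algebra `B` with itself. -/
structure TensorSquareSetting (B : Type u) (TB : Type v)
    [NonUnitalNormedRing B] [NormedSpace ℂ B] [CompleteSpace B]
    [NonUnitalNormedRing TB] [NormedSpace ℂ TB] [CompleteSpace TB] where
  tp : B → B → TB
  tp_add_left : ∀ a b c, tp (a + b) c = tp a c + tp b c
  tp_add_right : ∀ a b c, tp a (b + c) = tp a b + tp a c
  tp_smul_left : ∀ (z : ℂ) a b, tp (z • a) b = z • tp a b
  tp_smul_right : ∀ (z : ℂ) a b, tp a (z • b) = z • tp a b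
  tp_norm : ∀ a b, ‖tp a b‖ ≤ ‖a‖ * ‖b‖
  tp_mul : ∀ a b c d, tp a b * tp c d = tp (a * c) (b * d)
  tp_dense :
    Dense ((Submodule.span ℂ (Set.range fun p : B × B => tp p.1 p.2) : Submodule ℂ TB) : Set TB)
  tp_universal : ∀ {X : Type w} [NormedAddCommGroup X] [NormedSpace ℂ X] [CompleteSpace X]
      (φ : B →L[ℂ] B →L[ℂ] X),
      ∃ ψ : TB →L[ℂ] X, ‖ψ‖ ≤ ‖φ‖ ∧ ∀ a b, ψ (tp a b) = φ a b
  lmul : B → TB →L[ℂ] TB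
  rmul : B → TB →L[ℂ] TB
  lmul_tp : ∀ a b c, lmul a (tp b c) = tp (a * b) c
  rmul_tp : ∀ a b c, rmul a (tp b c) = tp b (c * a)
  ω : TB →L[ℂ] B
  ω_tp : ∀ a b, ω (tp a b) = a * b

/-- A Banach algebra `B` is biprojective if the multiplication map
`ω : B ⊗̂ B → B` has a bounded right inverse which is a `B`-bimodule homomorphism. -/
def TensorSquareSetting.Biprojective {B : Type u} {TB : Type v}
    [NonUnitalNormedRing B] [NormedSpace ℂ B] [CompleteSpace B]
    [NonUnitalNormedRing TB] [NormedSpace ℂ TB] [CompleteSpace TB]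
    (ts : TensorSquareSetting B TB) : Prop :=
  ∃ ρ : B →L[ℂ] TB,
    (∀ a b, ρ (a * b) = ts.lmul a (ρ b)) ∧
    (∀ a b, ρ (b * a) = ts.rmul a (ρ b)) ∧
    (∀ a, ts.ω (ρ a) = a)

/-- A Banach algebra `B` is biflat if the adjoint `ω* : B* → (B ⊗̂ B)*` of the multiplication
map has a bounded left inverse which is a `B`-bimodule homomorphism (for the dual actions
`a · f = f(· a)` and `f · a = f(a ·)`). -/
def TensorSquareSetting.Biflat {B : Type u} {TB : Type v}
    [NonUnitalNormedRing B] [NormedSpace ℂ B] [CompleteSpace B]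
    [NonUnitalNormedRing TB] [NormedSpace ℂ TB] [CompleteSpace TB]
    [IsScalarTower ℂ B B] [SMulCommClass ℂ B B]
    (ts : TensorSquareSetting B TB) : Prop :=
  ∃ θ : (TB →L[ℂ] ℂ) →L[ℂ] (B →L[ℂ] ℂ),
    (∀ (a : B) (f : TB →L[ℂ] ℂ),
      θ (f.comp (ts.rmul a)) = (θ f).comp ((ContinuousLinearMap.mul ℂ B).flip a)) ∧
    (∀ (a : B) (f : TB →L[ℂ] ℂ),
      θ (f.comp (ts.lmul a)) = (θ f).comp (ContinuousLinearMap.mul ℂ B a)) ∧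
    (∀ g : B →L[ℂ] ℂ, θ (g.comp ts.ω) = g)

/-- Compatible bounded bimodule actions of a Banach algebra `𝔄` on a Banach algebra `𝒜`:
`lsmul α a = α · a` and `rsmul α a = a · α`, with `α · (a b) = (α · a) b` and
`(a b) · α = a (b · α)`. -/
structure ActionSetting (𝔄 : Type u₁) (𝒜 : Type u)
    [NonUnitalNormedRing 𝔄] [NormedSpace ℂ 𝔄] [CompleteSpace 𝔄]
    [NonUnitalNormedRing 𝒜] [NormedSpace ℂ 𝒜] [CompleteSpace 𝒜] where
  lsmul : 𝔄 → 𝒜 →L[ℂ] 𝒜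
  rsmul : 𝔄 → 𝒜 →L[ℂ] 𝒜
  lsmul_add : ∀ α β, lsmul (α + β) = lsmul α + lsmul β
  lsmul_smulc : ∀ (z : ℂ) α, lsmul (z • α) = z • lsmul α
  rsmul_add : ∀ α β, rsmul (α + β) = rsmul α + rsmul β
  rsmul_smulc : ∀ (z : ℂ) α, rsmul (z • α) = z • rsmul α
  lsmul_bound : ∃ C : ℝ, ∀ α, ‖lsmul α‖ ≤ C * ‖α‖
  rsmul_bound : ∃ C : ℝ, ∀ α, ‖rsmul α‖ ≤ C * ‖α‖
  lsmul_mulA : ∀ α β a, lsmul (α * β) a = lsmul α (lsmul β a)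
  rsmul_mulA : ∀ α β a, rsmul (α * β) a = rsmul β (rsmul α a)
  lsmul_rsmul : ∀ α β a, rsmul β (lsmul α a) = lsmul α (rsmul β a)
  lsmul_compat : ∀ α a b, lsmul α (a * b) = lsmul α a * b
  rsmul_compat : ∀ α a b, rsmul α (a * b) = a * rsmul α b

/-- The full setting of the paper: `𝒜` is a Banach algebra with compatible `𝔄`-actions,
`T = 𝒜 ⊗̂ 𝒜` is its projective tensor square carrying the induced `𝔄`-actions
(`tlsmul α (a ⊗ b) = (α·a) ⊗ b`, `trsmul α (a ⊗ b) = a ⊗ (b·α)`), `I ⊆ T` is the closed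
ideal generated by the elements `α·a ⊗ b - a ⊗ b·α`, `J ⊆ 𝒜` is the closed ideal generated
by `ω(I)`, and the induced bounded operators on the quotient Banach spaces
`T ⧸ I = 𝒜 ⊗̂_𝔄 𝒜` and `𝒜 ⧸ J` are recorded: `qω` is the induced multiplication map `ω̃`,
`qlsmul/qrsmul` (resp. `qtlsmul/qtrsmul`) are the induced `𝔄`-actions on `𝒜 ⧸ J`
(resp. `T ⧸ I`), and `qmulL/qmulR` (resp. `qlmul/qrmul`) are the induced `𝒜`- (hence
`𝒜/J`-) bimodule actions on `𝒜 ⧸ J` (resp. `T ⧸ I`). -/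
structure ModuleSetting (𝔄 : Type u₁) (𝒜 : Type u) (T : Type v)
    [NonUnitalNormedRing 𝔄] [NormedSpace ℂ 𝔄] [CompleteSpace 𝔄]
    [NonUnitalNormedRing 𝒜] [NormedSpace ℂ 𝒜] [CompleteSpace 𝒜]
    [NonUnitalNormedRing T] [NormedSpace ℂ T] [CompleteSpace T] extends
    TensorSquareSetting 𝒜 T, ActionSetting 𝔄 𝒜 where
  tlsmul : 𝔄 → T →L[ℂ] T
  trsmul : 𝔄 → T →L[ℂ] T
  tlsmul_tp : ∀ α a b, tlsmul α (tp a b) = tp (lsmul α a) b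
  trsmul_tp : ∀ α a b, trsmul α (tp a b) = tp a (rsmul α b)
  I : Submodule ℂ T
  J : Submodule ℂ 𝒜
  hI : I = closedIdealGen
    {x : T | ∃ (α : 𝔄) (a b : 𝒜), x = tlsmul α (tp a b) - trsmul α (tp a b)}
  hJ : J = closedIdealGen (ω '' I)
  qω : (T ⧸ I) →L[ℂ] (𝒜 ⧸ J)
  qω_mk : ∀ t, qω (Submodule.Quotient.mk t) = Submodule.Quotient.mk (ω t)
  qlsmul : 𝔄 → (𝒜 ⧸ J) →L[ℂ] (𝒜 ⧸ J)
  qrsmul : 𝔄 → (𝒜 ⧸ J) →L[ℂ] (𝒜 ⧸ J)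
  qlsmul_mk : ∀ α a, qlsmul α (Submodule.Quotient.mk a) = Submodule.Quotient.mk (lsmul α a)
  qrsmul_mk : ∀ α a, qrsmul α (Submodule.Quotient.mk a) = Submodule.Quotient.mk (rsmul α a)
  qmulL : 𝒜 → (𝒜 ⧸ J) →L[ℂ] (𝒜 ⧸ J)
  qmulR : 𝒜 → (𝒜 ⧸ J) →L[ℂ] (𝒜 ⧸ J)
  qmulL_mk : ∀ a b, qmulL a (Submodule.Quotient.mk b) = Submodule.Quotient.mk (a * b)
  qmulR_mk : ∀ a b, qmulR a (Submodule.Quotient.mk b) = Submodule.Quotient.mk (b * a)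
  qtlsmul : 𝔄 → (T ⧸ I) →L[ℂ] (T ⧸ I)
  qtrsmul : 𝔄 → (T ⧸ I) →L[ℂ] (T ⧸ I)
  qtlsmul_mk : ∀ α t, qtlsmul α (Submodule.Quotient.mk t) = Submodule.Quotient.mk (tlsmul α t)
  qtrsmul_mk : ∀ α t, qtrsmul α (Submodule.Quotient.mk t) = Submodule.Quotient.mk (trsmul α t)
  qlmul : 𝒜 → (T ⧸ I) →L[ℂ] (T ⧸ I)
  qrmul : 𝒜 → (T ⧸ I) →L[ℂ] (T ⧸ I)
  qlmul_mk : ∀ a t, qlmul a (Submodule.Quotient.mk t) = Submodule.Quotient.mk (lmul a t)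
  qrmul_mk : ∀ a t, qrmul a (Submodule.Quotient.mk t) = Submodule.Quotient.mk (rmul a t)

namespace ModuleSetting

variable {𝔄 : Type u₁} {𝒜 : Type u} {T : Type v}
    [NonUnitalNormedRing 𝔄] [NormedSpace ℂ 𝔄] [CompleteSpace 𝔄]
    [NonUnitalNormedRing 𝒜] [NormedSpace ℂ 𝒜] [CompleteSpace 𝒜]
    [NonUnitalNormedRing T] [NormedSpace ℂ T] [CompleteSpace T]

/-- `𝒜` is module biprojective (as an `𝔄`-module) if the induced multiplication map
`ω̃ : 𝒜 ⊗̂_𝔄 𝒜 → 𝒜 ⧸ J` has a bounded right inverse which is an `𝒜/J`-`𝔄`-module morphism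
(a bounded additive map commuting with the `𝔄`-actions and the `𝒜/J`-bimodule actions). -/
def ModuleBiprojective (S : ModuleSetting 𝔄 𝒜 T) : Prop :=
  ∃ ρ : (𝒜 ⧸ S.J) → (T ⧸ S.I),
    (∀ x y, ρ (x + y) = ρ x + ρ y) ∧
    (∃ C : ℝ, ∀ x, ‖ρ x‖ ≤ C * ‖x‖) ∧
    (∀ α x, ρ (S.qlsmul α x) = S.qtlsmul α (ρ x)) ∧
    (∀ α x, ρ (S.qrsmul α x) = S.qtrsmul α (ρ x)) ∧
    (∀ a x, ρ (S.qmulL a x) = S.qlmul a (ρ x)) ∧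
    (∀ a x, ρ (S.qmulR a x) = S.qrmul a (ρ x)) ∧
    (∀ x, S.qω (ρ x) = x)

/-- `𝒜` is module biflat (as an `𝔄`-module) if the adjoint
`ω̃* : (𝒜 ⧸ J)* → (𝒜 ⊗̂_𝔄 𝒜)*` has a bounded left inverse which is an `𝒜/J`-`𝔄`-module
morphism (for the dual actions). -/
def ModuleBiflat (S : ModuleSetting 𝔄 𝒜 T) : Prop :=
  ∃ θ : ((T ⧸ S.I) →L[ℂ] ℂ) → ((𝒜 ⧸ S.J) →L[ℂ] ℂ),
    (∀ f g, θ (f + g) = θ f + θ g) ∧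
    (∃ C : ℝ, ∀ f, ‖θ f‖ ≤ C * ‖f‖) ∧
    (∀ α f, θ (f.comp (S.qtrsmul α)) = (θ f).comp (S.qrsmul α)) ∧
    (∀ α f, θ (f.comp (S.qtlsmul α)) = (θ f).comp (S.qlsmul α)) ∧
    (∀ a f, θ (f.comp (S.qrmul a)) = (θ f).comp (S.qmulR a)) ∧
    (∀ a f, θ (f.comp (S.qlmul a)) = (θ f).comp (S.qmulL a)) ∧
    (∀ g : (𝒜 ⧸ S.J) →L[ℂ] ℂ, θ (g.comp S.qω) = g)

/-- `𝔄` acts trivially on `𝒜` from the left, via the continuous functional `f`: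
`α · a = f(α) a`. -/
def TrivialLeftAction (S : ModuleSetting 𝔄 𝒜 T) (f : 𝔄 →L[ℂ] ℂ) : Prop :=
  ∀ α a, S.lsmul α a = f α • a

/-- The quotient algebra `𝒜 ⧸ J` has a left identity `e + J`. -/
def HasLeftIdentity (S : ModuleSetting 𝔄 𝒜 T) : Prop :=
  ∃ e : 𝒜, ∀ x : 𝒜 ⧸ S.J, S.qmulL e x = x

/-- The quotient algebra `𝒜 ⧸ J` has an identity `e + J`. -/
def HasIdentity (S : ModuleSetting 𝔄 𝒜 T) : Prop :=
  ∃ e : 𝒜, ∀ x : 𝒜 ⧸ S.J, S.qmulL e x = x ∧ S.qmulR e x = x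

/-- `𝔄` has a bounded approximate identity for `𝒜`: a bounded net `(α_j)` in `𝔄` with
`‖α_j · a - a‖ → 0` and `‖a · α_j - a‖ → 0` for every `a ∈ 𝒜`. -/
def HasBoundedApproximateIdentityFor (S : ModuleSetting 𝔄 𝒜 T) : Prop :=
  ∃ C : ℝ, 0 < C ∧ ∀ ε : ℝ, 0 < ε → ∀ F : Finset 𝒜, ∃ α : 𝔄, ‖α‖ ≤ C ∧
    ∀ a ∈ F, ‖S.lsmul α a - a‖ < ε ∧ ‖S.rsmul α a - a‖ < ε

/-- The quotient algebra `𝒜 ⧸ J` has a bounded approximate identity. -/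
def QuotientHasBoundedApproximateIdentity (S : ModuleSetting 𝔄 𝒜 T) : Prop :=
  ∃ C : ℝ, 0 < C ∧ ∀ ε : ℝ, 0 < ε → ∀ F : Finset (𝒜 ⧸ S.J), ∃ e : 𝒜,
    ‖(Submodule.Quotient.mk e : 𝒜 ⧸ S.J)‖ ≤ C ∧
    ∀ x ∈ F, ‖S.qmulL e x - x‖ < ε ∧ ‖S.qmulR e x - x‖ < ε

/-- `𝒜 ⧸ J` is a commutative `𝔄`-module. -/
def QuotientCommutative (S : ModuleSetting 𝔄 𝒜 T) : Prop :=
  ∀ (α : 𝔄) (x : 𝒜 ⧸ S.J), S.qlsmul α x = S.qrsmul α x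

end ModuleSetting

/-- `p : 𝒜 → B` exhibits the Banach algebra `B` as the quotient Banach algebra `𝒜 ⧸ J`:
it is a surjective multiplicative bounded linear map with kernel `J` which identifies the
norm of `B` with the quotient norm of `𝒜 ⧸ J`. -/
structure IsQuotientBanachAlgebraOf {𝒜 : Type u} (B : Type u₂)
    [NonUnitalNormedRing 𝒜] [NormedSpace ℂ 𝒜] [CompleteSpace 𝒜]
    [NonUnitalNormedRing B] [NormedSpace ℂ B] [CompleteSpace B]
    (J : Submodule ℂ 𝒜) (p : 𝒜 → B) : Prop where
  map_add : ∀ a b, p (a + b) = p a + p b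
  map_smul : ∀ (z : ℂ) (a : 𝒜), p (z • a) = z • p a
  map_mul : ∀ a b, p (a * b) = p a * p b
  surjective : Function.Surjective p
  ker : ∀ a, p a = 0 ↔ a ∈ J
  norm_eq : ∀ a, ‖p a‖ = ‖(Submodule.Quotient.mk a : 𝒜 ⧸ J)‖

theorem subset_closedIdealGen {R : Type u} [NonUnitalNormedRing R] [NormedSpace ℂ R]
    (s : Set R) : s ⊆ (closedIdealGen s : Set R) := by
  intro x hx
  simp only [closedIdealGen, SetLike.mem_coe, Submodule.mem_sInf, Set.mem_ofPred_eq]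
  exact fun q hq => hq.1 hx

theorem closedIdealGen_le {R : Type u} [NonUnitalNormedRing R] [NormedSpace ℂ R]
    {s : Set R} {q : Submodule ℂ R} (hs : s ⊆ (q : Set R)) (hc : IsClosed (q : Set R))
    (hq : ∀ x ∈ q, ∀ y : R, x * y ∈ q ∧ y * x ∈ q) : closedIdealGen s ≤ q :=
  sInf_le ⟨hs, hc, hq⟩

namespace TensorSquareSetting

variable {B : Type u} {TB : Type v}
  [NonUnitalNormedRing B] [NormedSpace ℂ B] [CompleteSpace B]
  [NonUnitalNormedRing TB] [NormedSpace ℂ TB] [CompleteSpace TB]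

theorem induction_on (ts : TensorSquareSetting.{u, v, w} B TB) {P : TB → Prop}
    (hc : IsClosed {t | P t}) (ha : ∀ s t, P s → P t → P (s + t))
    (ht : ∀ a b, P (ts.tp a b)) (t : TB) : P t := by
  have key : ∀ t ∈ Submodule.span ℂ (Set.range fun q : B × B => ts.tp q.1 q.2),
      ∀ z : ℂ, P (z • t) := by
    intro t h
    induction h using Submodule.span_induction with
    | mem x hx =>
      obtain ⟨⟨a, b⟩, rfl⟩ := hx
      intro z
      simpa only [← ts.tp_smul_left] using ht (z • a) b
    | zero =>
      intro z
      have h0 : ts.tp 0 0 = 0 := by simpa using ts.tp_smul_left 0 0 0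
      simpa [h0] using ht 0 0
    | add x y _ _ hx hy => intro z; rw [smul_add]; exact ha _ _ (hx z) (hy z)
    | smul c x _ hx => intro z; rw [smul_smul]; exact hx _
  have hd : closure _ ⊆ {t | P t} :=
    closure_minimal (fun t h => by simpa using key t h 1) hc
  exact hd (ts.tp_dense t)

theorem continuousLinearMap_ext (ts : TensorSquareSetting.{u, v, w} B TB) {X : Type*}
    [NormedAddCommGroup X] [NormedSpace ℂ X] {φ ψ : TB →L[ℂ] X}
    (h : ∀ a b, φ (ts.tp a b) = ψ (ts.tp a b)) : φ = ψ := by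
  ext t
  refine ts.induction_on (P := fun t => φ t = ψ t)
    (isClosed_eq φ.continuous ψ.continuous) ?_ h t
  intro s t hs ht
  rw [map_add, map_add, hs, ht]

theorem isScalarTower_base (ts : TensorSquareSetting.{u, v, w} B TB) : IsScalarTower ℂ B B :=
  ⟨fun z a b => by
    rw [smul_eq_mul, smul_eq_mul, ← ts.ω_tp, ts.tp_smul_left, map_smul, ts.ω_tp]⟩

theorem smulCommClass_base (ts : TensorSquareSetting.{u, v, w} B TB) : SMulCommClass ℂ B B :=
  ⟨fun z a b => by
    rw [smul_eq_mul, smul_eq_mul, ← ts.ω_tp a (z • b), ts.tp_smul_right, map_smul, ts.ω_tp]⟩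

theorem isScalarTower (ts : TensorSquareSetting.{u, v, w} B TB) : IsScalarTower ℂ TB TB := by
  refine ⟨fun z s t => ?_⟩
  have := ts.isScalarTower_base
  simp only [smul_eq_mul]
  refine ts.induction_on (P := fun s => (z • s) * t = z • (s * t))
    (isClosed_eq (by fun_prop) (by fun_prop)) ?_ ?_ s
  · intro x y hx hy
    rw [smul_add, add_mul, add_mul, smul_add, hx, hy]
  intro a b
  refine ts.induction_on (P := fun t => (z • ts.tp a b) * t = z • (ts.tp a b * t))
    (isClosed_eq (by fun_prop) (by fun_prop)) ?_ ?_ t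
  · intro x y hx hy
    rw [mul_add, mul_add, smul_add, hx, hy]
  intro c d
  rw [← ts.tp_smul_left, ts.tp_mul, ts.tp_mul, ← ts.tp_smul_left, smul_mul_assoc]

theorem smulCommClass (ts : TensorSquareSetting.{u, v, w} B TB) : SMulCommClass ℂ TB TB := by
  refine ⟨fun z s t => ?_⟩
  have := ts.smulCommClass_base
  simp only [smul_eq_mul]
  refine ts.induction_on (P := fun s => z • (s * t) = s * (z • t))
    (isClosed_eq (by fun_prop) (by fun_prop)) ?_ ?_ s
  · intro x y hx hy
    rw [add_mul, add_mul, smul_add, hx, hy]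
  intro a b
  refine ts.induction_on (P := fun t => z • (ts.tp a b * t) = ts.tp a b * (z • t))
    (isClosed_eq (by fun_prop) (by fun_prop)) ?_ ?_ t
  · intro x y hx hy
    rw [smul_add, mul_add, mul_add, smul_add, hx, hy]
  intro c d
  rw [← ts.tp_smul_right, ts.tp_mul, ts.tp_mul, ← ts.tp_smul_right, mul_smul_comm]

/-- The universal property for scalar-valued bilinear forms, independently of the universe in
which `TensorSquareSetting.tp_universal` is stated. -/
theorem exists_lift_scalar (ts : TensorSquareSetting.{u, v, w} B TB) (φ : B →L[ℂ] B →L[ℂ] ℂ) :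
    ∃ ψ : TB →L[ℂ] ℂ, ‖ψ‖ ≤ ‖φ‖ ∧ ∀ a b, ψ (ts.tp a b) = φ a b := by
  let e : ULift.{w} ℂ ≃ₗᵢ[ℂ] ℂ := LinearIsometryEquiv.ulift ℂ ℂ
  let eL : ULift.{w} ℂ →L[ℂ] ℂ := e.toContinuousLinearEquiv
  let eR : ℂ →L[ℂ] ULift.{w} ℂ := e.symm.toContinuousLinearEquiv
  obtain ⟨ψ, hψ, h⟩ := ts.tp_universal ((ContinuousLinearMap.compL ℂ B ℂ (ULift.{w} ℂ) eR).comp φ)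
  refine ⟨eL.comp ψ, ?_, fun a b => ?_⟩
  · refine ContinuousLinearMap.opNorm_le_bound _ φ.opNorm_nonneg fun t => ?_
    have h₁ : ‖(eL.comp ψ) t‖ = ‖ψ t‖ := e.norm_map (ψ t)
    rw [h₁]
    refine (ψ.le_opNorm t).trans (mul_le_mul_of_nonneg_right (hψ.trans ?_) (norm_nonneg t))
    refine ContinuousLinearMap.opNorm_le_bound₂ _ φ.opNorm_nonneg fun a b => ?_
    have h₂ : ‖((ContinuousLinearMap.compL ℂ B ℂ (ULift.{w} ℂ) eR).comp φ) a b‖ = ‖φ a b‖ :=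
      e.symm.norm_map (φ a b)
    rw [h₂]
    exact φ.le_opNorm₂ a b
  · change e (ψ (ts.tp a b)) = φ a b
    rw [h]
    exact e.apply_symm_apply (φ a b)

/-- The elementary tensor map as a bounded bilinear map. -/
def tpL (ts : TensorSquareSetting.{u, v, w} B TB) : B →L[ℂ] B →L[ℂ] TB :=
  LinearMap.mkContinuous₂
    (LinearMap.mk₂ ℂ ts.tp ts.tp_add_left ts.tp_smul_left ts.tp_add_right
      fun z a b => ts.tp_smul_right z a b) 1
    fun a b => by simpa using ts.tp_norm a b

end TensorSquareSetting

namespace IsQuotientBanachAlgebraOf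

variable {𝒜 : Type u} {B : Type u₂}
  [NonUnitalNormedRing 𝒜] [NormedSpace ℂ 𝒜] [CompleteSpace 𝒜]
  [NonUnitalNormedRing B] [NormedSpace ℂ B] [CompleteSpace B]
  {J : Submodule ℂ 𝒜} {p : 𝒜 → B}

/-- The quotient map as a bounded linear map. -/
def toCLM (hp : IsQuotientBanachAlgebraOf B J p) : 𝒜 →L[ℂ] B :=
  LinearMap.mkContinuous ⟨⟨p, hp.map_add⟩, hp.map_smul⟩ 1 fun a => by
    simpa using (hp.norm_eq a).le.trans (Submodule.Quotient.norm_mk_le J a)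

/-- The isometric identification of `𝒜 ⧸ J` with `B`. -/
def isometryEquiv (hp : IsQuotientBanachAlgebraOf B J p) : (𝒜 ⧸ J) ≃ₗᵢ[ℂ] B where
  toLinearEquiv := LinearEquiv.ofBijective
    (J.liftQ (hp.toCLM : 𝒜 →ₗ[ℂ] B) fun a ha => (hp.ker a).2 ha) <| by
      refine ⟨?_, fun b => ?_⟩
      · exact LinearMap.ker_eq_bot.1 <|
          Submodule.ker_liftQ_eq_bot _ _ _ fun a ha => (hp.ker a).1 ha
      · obtain ⟨a, rfl⟩ := hp.surjective b
        exact ⟨Submodule.Quotient.mk a, rfl⟩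
  norm_map' x := by
    obtain ⟨a, rfl⟩ := Submodule.Quotient.mk_surjective J x
    exact hp.norm_eq a

@[simp]
theorem isometryEquiv_mk (hp : IsQuotientBanachAlgebraOf B J p) (a : 𝒜) :
    hp.isometryEquiv (Submodule.Quotient.mk a) = p a := rfl

@[simp]
theorem isometryEquiv_symm_apply (hp : IsQuotientBanachAlgebraOf B J p) (a : 𝒜) :
    hp.isometryEquiv.symm (p a) = Submodule.Quotient.mk a := by
  rw [LinearIsometryEquiv.symm_apply_eq, isometryEquiv_mk]

end IsQuotientBanachAlgebraOf

namespace ModuleSetting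

variable {𝔄 : Type u₁} {𝒜 : Type u} {T : Type v}
  [NonUnitalNormedRing 𝔄] [NormedSpace ℂ 𝔄] [CompleteSpace 𝔄]
  [NonUnitalNormedRing 𝒜] [NormedSpace ℂ 𝒜] [CompleteSpace 𝒜]
  [NonUnitalNormedRing T] [NormedSpace ℂ T] [CompleteSpace T]

theorem quotient_ext (S : ModuleSetting.{u, u₁, v, w} 𝔄 𝒜 T) {φ ψ : (T ⧸ S.I) →L[ℂ] ℂ}
    (h : ∀ a b, φ (Submodule.Quotient.mk (S.tp a b)) = ψ (Submodule.Quotient.mk (S.tp a b))) :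
    φ = ψ := by
  have hφψ : φ.comp S.I.mkQL = ψ.comp S.I.mkQL := S.continuousLinearMap_ext h
  ext x
  obtain ⟨t, rfl⟩ := Submodule.Quotient.mk_surjective S.I x
  exact congrArg (fun φ : T →L[ℂ] ℂ => φ t) hφψ

theorem smul_sub_rsmul_mem_J (S : ModuleSetting.{u, u₁, v, w} 𝔄 𝒜 T) {f : 𝔄 →L[ℂ] ℂ}
    (hf : S.TrivialLeftAction f) (hid : S.HasLeftIdentity) (α : 𝔄) (b : 𝒜) :
    f α • b - S.rsmul α b ∈ S.J := by
  obtain ⟨e, he⟩ := hid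
  have := S.smulCommClass_base
  have hI : S.tlsmul α (S.tp e b) - S.trsmul α (S.tp e b) ∈ S.I := by
    rw [S.hI]
    exact subset_closedIdealGen _ ⟨α, e, b, rfl⟩
  have hJ : e * (f α • b - S.rsmul α b) ∈ S.J := by
    have h : S.ω (S.tlsmul α (S.tp e b) - S.trsmul α (S.tp e b)) ∈ S.J := by
      rw [S.hJ]
      exact subset_closedIdealGen _ ⟨_, hI, rfl⟩
    rwa [S.tlsmul_tp, S.trsmul_tp, map_sub, S.ω_tp, S.ω_tp, ← S.lsmul_compat, hf,
      ← mul_smul_comm, ← mul_sub] at h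
  have h := he (Submodule.Quotient.mk (f α • b - S.rsmul α b))
  rw [S.qmulL_mk, (Submodule.Quotient.mk_eq_zero S.J).2 hJ] at h
  exact (Submodule.Quotient.mk_eq_zero S.J).1 h.symm

theorem qlsmul_eq (S : ModuleSetting.{u, u₁, v, w} 𝔄 𝒜 T) {f : 𝔄 →L[ℂ] ℂ}
    (hf : S.TrivialLeftAction f) (α : 𝔄) (x : 𝒜 ⧸ S.J) : S.qlsmul α x = f α • x := by
  obtain ⟨a, rfl⟩ := Submodule.Quotient.mk_surjective S.J x
  rw [S.qlsmul_mk, hf, Submodule.Quotient.mk_smul]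

theorem comp_qtlsmul_eq (S : ModuleSetting.{u, u₁, v, w} 𝔄 𝒜 T) {f : 𝔄 →L[ℂ] ℂ}
    (hf : S.TrivialLeftAction f) (α : 𝔄) (φ : (T ⧸ S.I) →L[ℂ] ℂ) :
    φ.comp (S.qtlsmul α) = f α • φ := by
  refine S.quotient_ext fun a b => ?_
  rw [ContinuousLinearMap.comp_apply, S.qtlsmul_mk, S.tlsmul_tp, hf, S.tp_smul_left,
    Submodule.Quotient.mk_smul, map_smul]
  rfl

theorem subsingleton_of_eq_zero (S : ModuleSetting.{u, u₁, v, w} 𝔄 𝒜 T) {f : 𝔄 →L[ℂ] ℂ}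
    (hf : S.TrivialLeftAction f) (hbai : S.HasBoundedApproximateIdentityFor)
    (h0 : ∀ α, f α = 0) : Subsingleton 𝒜 := by
  refine subsingleton_of_forall_eq 0 fun a => ?_
  by_contra ha
  obtain ⟨C, -, h⟩ := hbai
  obtain ⟨α, -, hα⟩ := h ‖a‖ (norm_pos_iff.2 ha) {a}
  have := (hα a (Finset.mem_singleton_self a)).1
  rw [hf, h0, zero_smul, zero_sub, norm_neg] at this
  exact lt_irrefl _ this

theorem map_smul_of_commute_qtlsmul (S : ModuleSetting.{u, u₁, v, w} 𝔄 𝒜 T) {f : 𝔄 →L[ℂ] ℂ}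
    (hf : S.TrivialLeftAction f) (hbai : S.HasBoundedApproximateIdentityFor)
    {θ : ((T ⧸ S.I) →L[ℂ] ℂ) → ((𝒜 ⧸ S.J) →L[ℂ] ℂ)}
    (hθ : ∀ α φ, θ (φ.comp (S.qtlsmul α)) = (θ φ).comp (S.qlsmul α))
    (z : ℂ) (φ : (T ⧸ S.I) →L[ℂ] ℂ) : θ (z • φ) = z • θ φ := by
  by_cases h0 : ∀ α, f α = 0
  · have := S.subsingleton_of_eq_zero hf hbai h0
    ext x
    obtain ⟨a, rfl⟩ := Submodule.Quotient.mk_surjective S.J x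
    rw [Subsingleton.elim a 0, Submodule.Quotient.mk_zero, map_zero, map_zero]
  · push Not at h0
    obtain ⟨α, hα⟩ := h0
    have hz : f ((z / f α) • α) = z := by
      rw [map_smul, smul_eq_mul, div_mul_cancel₀ _ hα]
    have h := hθ ((z / f α) • α) φ
    rw [S.comp_qtlsmul_eq hf, hz] at h
    rw [h]
    ext x
    rw [ContinuousLinearMap.comp_apply, S.qlsmul_eq hf, hz, map_smul]
    rfl

section Pullback

variable {B : Type u₂} {TB : Type u₃}
  [NonUnitalNormedRing B] [NormedSpace ℂ B] [CompleteSpace B]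
  [NonUnitalNormedRing TB] [NormedSpace ℂ TB] [CompleteSpace TB]

/-- Functionals on `𝒜 ⊗̂ 𝒜` induced from functionals on `B ⊗̂ B` kill the ideal `I`. -/
theorem apply_eq_zero_of_mem_I (S : ModuleSetting.{u, u₁, v, w} 𝔄 𝒜 T) {f : 𝔄 →L[ℂ] ℂ}
    (hf : S.TrivialLeftAction f) (hid : S.HasLeftIdentity)
    {p : 𝒜 → B} (hp : IsQuotientBanachAlgebraOf B S.J p)
    (tsB : TensorSquareSetting B TB) {G : TB →L[ℂ] ℂ} {ψ : T →L[ℂ] ℂ}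
    (hψ : ∀ a b, ψ (S.tp a b) = G (tsB.tp (p a) (p b))) {t : T} (ht : t ∈ S.I) : ψ t = 0 := by
  have := S.isScalarTower
  have := S.smulCommClass
  have := tsB.isScalarTower
  have := tsB.smulCommClass
  let K : Submodule ℂ T := ⨅ (G : TB →L[ℂ] ℂ) (ψ : T →L[ℂ] ℂ)
    (_ : ∀ a b, ψ (S.tp a b) = G (tsB.tp (p a) (p b))), ψ.ker
  have mem_K : ∀ t, t ∈ K ↔ ∀ (G : TB →L[ℂ] ℂ) (ψ : T →L[ℂ] ℂ),
      (∀ a b, ψ (S.tp a b) = G (tsB.tp (p a) (p b))) → ψ t = 0 := fun t => by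
    simp [K, Submodule.mem_iInf]
  suffices hIK : S.I ≤ K from (mem_K t).1 (hIK ht) G ψ hψ
  rw [S.hI]
  refine closedIdealGen_le ?_ ?_ fun x hx y => ⟨?_, ?_⟩
  · rintro _ ⟨α, a, b, rfl⟩
    refine (mem_K _).2 fun G ψ hψ => ?_
    have h := (hp.ker _).2 (S.smul_sub_rsmul_mem_J hf hid α b)
    have hsub : p (f α • b) = p (S.rsmul α b) := by
      have : hp.toCLM (f α • b - S.rsmul α b) = 0 := h
      rw [map_sub, sub_eq_zero] at this
      exact this
    rw [S.tlsmul_tp, S.trsmul_tp, hf, S.tp_smul_left, ← S.tp_smul_right, map_sub, hψ, hψ, hsub,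
      sub_self]
  · simp only [K, Submodule.coe_iInf]
    exact isClosed_iInter fun G => isClosed_iInter fun ψ => isClosed_iInter fun _ => ψ.isClosed_ker
  · refine (mem_K _).2 fun G ψ hψ => ?_
    refine S.induction_on (P := fun y => ψ (x * y) = 0)
      (isClosed_eq (by fun_prop) continuous_const) ?_ ?_ y
    · intro s t hs ht
      rw [mul_add, map_add, hs, ht, add_zero]
    · intro c d
      refine (mem_K x).1 hx
        (G.comp ((ContinuousLinearMap.mul ℂ TB).flip (tsB.tp (p c) (p d))))
        (ψ.comp ((ContinuousLinearMap.mul ℂ T).flip (S.tp c d))) fun a b => ?_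
      simp [S.tp_mul, tsB.tp_mul, hψ, hp.map_mul]
  · refine (mem_K _).2 fun G ψ hψ => ?_
    refine S.induction_on (P := fun y => ψ (y * x) = 0)
      (isClosed_eq (by fun_prop) continuous_const) ?_ ?_ y
    · intro s t hs ht
      rw [add_mul, map_add, hs, ht, add_zero]
    · intro c d
      refine (mem_K x).1 hx
        (G.comp (ContinuousLinearMap.mul ℂ TB (tsB.tp (p c) (p d))))
        (ψ.comp (ContinuousLinearMap.mul ℂ T (S.tp c d))) fun a b => ?_
      simp [S.tp_mul, tsB.tp_mul, hψ, hp.map_mul]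

theorem exists_pullback (S : ModuleSetting.{u, u₁, v, w} 𝔄 𝒜 T) {f : 𝔄 →L[ℂ] ℂ}
    (hf : S.TrivialLeftAction f) (hid : S.HasLeftIdentity)
    {p : 𝒜 → B} (hp : IsQuotientBanachAlgebraOf B S.J p)
    (tsB : TensorSquareSetting B TB) (G : TB →L[ℂ] ℂ) :
    ∃ φ : (T ⧸ S.I) →L[ℂ] ℂ, ‖φ‖ ≤ ‖G‖ ∧
      ∀ a b, φ (Submodule.Quotient.mk (S.tp a b)) = G (tsB.tp (p a) (p b)) := by
  let β : 𝒜 →L[ℂ] 𝒜 →L[ℂ] ℂ :=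
    ((ContinuousLinearMap.compL ℂ B TB ℂ G).comp tsB.tpL).bilinearComp hp.toCLM hp.toCLM
  have hβ : ∀ a b, β a b = G (tsB.tp (p a) (p b)) := fun a b => rfl
  have hβn : ‖β‖ ≤ ‖G‖ := by
    have hpn : ∀ a, ‖p a‖ ≤ ‖a‖ := fun a =>
      (hp.norm_eq a).le.trans (Submodule.Quotient.norm_mk_le S.J a)
    refine ContinuousLinearMap.opNorm_le_bound₂ _ (norm_nonneg _) fun a b => ?_
    rw [hβ, mul_assoc]
    refine (G.le_opNorm _).trans (mul_le_mul_of_nonneg_left ?_ (norm_nonneg _))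
    exact (tsB.tp_norm _ _).trans (mul_le_mul (hpn a) (hpn b) (norm_nonneg _) (norm_nonneg _))
  obtain ⟨ψ, hψn, hψ⟩ := S.exists_lift_scalar β
  have hker : S.I ≤ (ψ : T →ₗ[ℂ] ℂ).ker := fun t ht =>
    S.apply_eq_zero_of_mem_I hf hid hp tsB (fun a b => (hψ a b).trans (hβ a b)) ht
  have hbound : ∀ x, ‖S.I.liftQ (ψ : T →ₗ[ℂ] ℂ) hker x‖ ≤ ‖G‖ * ‖x‖ := by
    intro x
    refine le_of_forall_pos_le_add fun ε hε => ?_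
    have hG : 0 < ‖G‖ + 1 := by positivity
    obtain ⟨t, rfl, ht⟩ := Submodule.Quotient.norm_mk_lt (S := S.I) x (div_pos hε hG)
    calc ‖ψ t‖ ≤ ‖G‖ * ‖t‖ :=
          (ψ.le_opNorm t).trans (mul_le_mul_of_nonneg_right (hψn.trans hβn) (norm_nonneg t))
      _ ≤ ‖G‖ * (‖(Submodule.Quotient.mk t : T ⧸ S.I)‖ + ε / (‖G‖ + 1)) :=
          mul_le_mul_of_nonneg_left ht.le (norm_nonneg _)
      _ ≤ ‖G‖ * ‖(Submodule.Quotient.mk t : T ⧸ S.I)‖ + ε := by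
          rw [mul_add]
          gcongr
          rw [mul_div_assoc', div_le_iff₀ hG]
          nlinarith
  exact ⟨LinearMap.mkContinuous _ ‖G‖ hbound, LinearMap.mkContinuous_norm_le _ (norm_nonneg _) _,
    fun a b => (hψ a b).trans (hβ a b)⟩

end Pullback

end ModuleSetting

variable {𝔄 : Type u₁} {𝒜 : Type u} {T : Type v}
  [NonUnitalNormedRing 𝔄] [NormedSpace ℂ 𝔄] [CompleteSpace 𝔄]
  [NonUnitalNormedRing 𝒜] [NormedSpace ℂ 𝒜] [CompleteSpace 𝒜]
  [NonUnitalNormedRing T] [NormedSpace ℂ T] [CompleteSpace T]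

/-- Proposition 2.7.
Assume `𝔄` acts trivially on `𝒜` from the left, `𝒜 ⧸ J` has a left identity, and `𝔄` has a
bounded approximate identity for `𝒜`.  If `𝒜` is module biflat, then the quotient
Banach algebra `𝒜 ⧸ J` (realized as the Banach algebra `B`) is biflat. -/
theorem stmt4 {B : Type u₂} {TB : Type u₃}
    [NonUnitalNormedRing B] [NormedSpace ℂ B] [CompleteSpace B]
    [NonUnitalNormedRing TB] [NormedSpace ℂ TB] [CompleteSpace TB]
    [IsScalarTower ℂ B B] [SMulCommClass ℂ B B]
    (S : ModuleSetting 𝔄 𝒜 T) (f : 𝔄 →L[ℂ] ℂ)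
    (hf : S.TrivialLeftAction f)
    (hid : S.HasLeftIdentity)
    (hbai : S.HasBoundedApproximateIdentityFor)
    (p : 𝒜 → B) (hp : IsQuotientBanachAlgebraOf B S.J p)
    (tsB : TensorSquareSetting B TB)
    (hmod : S.ModuleBiflat) :
    tsB.Biflat := by
  obtain ⟨θ, hadd, ⟨C, hC⟩, -, hθl, hθR, hθL, hθω⟩ := hmod
  choose Φ hΦn hΦ using S.exists_pullback hf hid hp tsB
  let E : B →L[ℂ] (𝒜 ⧸ S.J) := hp.isometryEquiv.symm.toContinuousLinearEquiv
  let E' : (𝒜 ⧸ S.J) →L[ℂ] B := hp.isometryEquiv.toContinuousLinearEquiv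
  have hE : ∀ a, E (p a) = Submodule.Quotient.mk a := hp.isometryEquiv_symm_apply
  have hEn : ∀ b, ‖E b‖ = ‖b‖ := hp.isometryEquiv.symm.norm_map
  have hC₀ : ∀ G, ‖θ (Φ G)‖ ≤ |C| * ‖G‖ := fun G =>
    (hC _).trans (mul_le_mul (le_abs_self C) (hΦn G) (Φ G).opNorm_nonneg (abs_nonneg C))
  let θB : (TB →L[ℂ] ℂ) →ₗ[ℂ] (B →L[ℂ] ℂ) :=
    { toFun := fun G => (θ (Φ G)).comp E
      map_add' := fun G H => by
        have h : Φ (G + H) = Φ G + Φ H := S.quotient_ext fun a b => by simp [hΦ]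
        rw [h, hadd, ContinuousLinearMap.add_comp]
      map_smul' := fun z G => by
        have h : Φ (z • G) = z • Φ G := S.quotient_ext fun a b => by simp [hΦ]
        rw [h, S.map_smul_of_commute_qtlsmul hf hbai hθl, ContinuousLinearMap.smul_comp,
          RingHom.id_apply] }
  have hbound : ∀ G, ‖θB G‖ ≤ |C| * ‖G‖ := fun G =>
    ContinuousLinearMap.opNorm_le_bound _ (by positivity) fun b =>
      ((θ (Φ G)).le_opNorm (E b)).trans <| by
        rw [hEn]
        exact mul_le_mul_of_nonneg_right (hC₀ G) (norm_nonneg b)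
  refine ⟨θB.mkContinuous |C| hbound, fun b G => ?_, fun b G => ?_, fun g => ?_⟩
  · obtain ⟨a, rfl⟩ := hp.surjective b
    have h : Φ (G.comp (tsB.rmul (p a))) = (Φ G).comp (S.qrmul a) :=
      S.quotient_ext fun c d => by
        simp [hΦ, S.qrmul_mk, S.rmul_tp, tsB.rmul_tp, hp.map_mul]
    change (θ (Φ (G.comp (tsB.rmul (p a))))).comp E = _
    rw [h, hθR]
    ext b
    obtain ⟨c, rfl⟩ := hp.surjective b
    change θ (Φ G) (S.qmulR a (E (p c))) = θ (Φ G) (E (p c * p a))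
    rw [← hp.map_mul, hE, hE, S.qmulR_mk]
  · obtain ⟨a, rfl⟩ := hp.surjective b
    have h : Φ (G.comp (tsB.lmul (p a))) = (Φ G).comp (S.qlmul a) :=
      S.quotient_ext fun c d => by
        simp [hΦ, S.qlmul_mk, S.lmul_tp, tsB.lmul_tp, hp.map_mul]
    change (θ (Φ (G.comp (tsB.lmul (p a))))).comp E = _
    rw [h, hθL]
    ext b
    obtain ⟨c, rfl⟩ := hp.surjective b
    change θ (Φ G) (S.qmulL a (E (p c))) = θ (Φ G) (E (p a * p c))
    rw [← hp.map_mul, hE, hE, S.qmulL_mk]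
  · have h : Φ (g.comp tsB.ω) = (g.comp E').comp S.qω :=
      S.quotient_ext fun c d => by
        rw [hΦ]
        change g (tsB.ω _) = g (E' (S.qω _))
        rw [tsB.ω_tp, S.qω_mk, S.ω_tp, ← hp.map_mul]
        rfl
    change (θ (Φ (g.comp tsB.ω))).comp E = g
    rw [h, hθω]
    ext b
    exact congrArg g (hp.isometryEquiv.apply_symm_apply b)
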